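/- For integers 0 ≤ n < b^l and k ≥ l+1, the measure μ_k assigns mass b^{p-l} to the interval [n/b^l, (n+1)/b^l); i.e., μ_k([n/b^l,(n+1)/b^l)) = b^p · b^{-l}. -/

import Mathlib

open scoped BigOperators ENNReal
open MeasureTheory

/-- Number of (possibly overlapping) occurrences of the block `w` in `X`. -/
def occCount {α : Type*} [DecidableEq α] (w X : List α) : ℕ :=
  ((List.range X.length).filter fun i => (X.drop i).take w.length = w).length

/-- The base-`b` value of a digit string (most significant digit first). -/
def listVal (b : ℕ) (X : List (Fin b)) : ℕ :=
  X.foldl (fun a d => b * a + d.val) 0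

/-- The discrete measure `μ_k = Σ_X b^{-|X|} δ_{n(X)/b^{|X|}}`, summed over all strings
`X` over `{0,…,b-1}` with exactly `k` occurrences of `w`. -/
noncomputable def mu (b : ℕ) (w : List (Fin b)) (k : ℕ) : Measure ℝ :=
  Measure.sum fun X : {X : List (Fin b) // occCount w X = k} =>
    (((b : ℝ≥0∞) ^ X.1.length)⁻¹) •
      Measure.dirac ((listVal b X.1 : ℝ) / (b : ℝ) ^ X.1.length)

/-- `S_w(k) = Σ 1/m` over positive integers `m` whose minimal base-`b` representation
contains exactly `k` occurrences of `w`. -/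
noncomputable def Sw (b : ℕ) (w : List (Fin b)) (k : ℕ) : ℝ :=
  ∑' m : ℕ,
    if m ≠ 0 ∧ occCount (w.map Fin.val) (Nat.digits b m).reverse = k then (m : ℝ)⁻¹ else 0

open Filter Topology

section Occurrences

variable {α : Type*} [DecidableEq α]

lemma occCount_nil (w : List α) : occCount w [] = 0 := by
  simp [occCount]

lemma occCount_le_length (w X : List α) : occCount w X ≤ X.length := by
  unfold occCount
  exact (List.length_filter_le _ _).trans (by simp)

lemma occCount_cons (w : List α) (a : α) (X : List α) :
    occCount w (a :: X) = occCount w X + if w <+: a :: X then 1 else 0 := by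
  have h : ((a :: X).take w.length = w) ↔ w <+: a :: X := by
    rw [List.prefix_iff_eq_take, eq_comm]
  unfold occCount
  rw [List.length_cons, List.range_succ_eq_map, List.filter_cons, List.filter_map,
    List.drop_zero]
  by_cases hp : w <+: a :: X
  · simp [h.2 hp, hp, Function.comp_def]
  · have := mt h.1 hp
    simp [this, hp, Function.comp_def]

lemma occCount_eq_zero_of_length_lt (w X : List α) (h : X.length < w.length) :
    occCount w X = 0 := by
  induction X with
  | nil => exact occCount_nil w
  | cons a X ih =>
    rw [occCount_cons, ih (by simp at h; omega), if_neg]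
    intro hp
    exact absurd hp.length_le (by omega)

lemma occCount_self (w : List α) (hw : 1 ≤ w.length) : occCount w w = 1 := by
  cases w with
  | nil => simp at hw
  | cons a v =>
    rw [occCount_cons, occCount_eq_zero_of_length_lt _ _ (by simp)]
    simp

lemma occCount_le_append_left (w X Z : List α) : occCount w Z ≤ occCount w (X ++ Z) := by
  induction X with
  | nil => simp
  | cons a X ih =>
    rw [List.cons_append, occCount_cons]
    omega

lemma occCount_le_append_right (w X Z : List α) : occCount w X ≤ occCount w (X ++ Z) := by
  induction X with
  | nil => simp [occCount_nil]
  | cons a X ih =>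
    rw [List.cons_append, occCount_cons, occCount_cons]
    by_cases hp : w <+: a :: X
    · have : w <+: a :: (X ++ Z) := hp.trans (List.prefix_append (a :: X) Z)
      rw [if_pos hp, if_pos this]
      omega
    · rw [if_neg hp]
      omega

lemma occCount_concat (w : List α) (hw : 1 ≤ w.length) (X : List α) (d : α) :
    occCount w (X ++ [d]) = occCount w X + if w <:+ X ++ [d] then 1 else 0 := by
  induction X with
  | nil =>
    have : w <+: [d] ↔ w <:+ [d] := by
      constructor
      · intro h
        rw [h.eq_of_length (by have := h.length_le; simp at *; omega)]
      · intro h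
        rw [h.eq_of_length (by have := h.length_le; simp at *; omega)]
    simp only [List.nil_append, occCount_cons, occCount_nil, this]
  | cons a X ih =>
    rw [List.cons_append, occCount_cons, ih, occCount_cons]
    rcases le_or_gt w.length (X.length + 1) with h | h
    · have h1 : w <+: a :: (X ++ [d]) ↔ w <+: a :: X :=
        ⟨fun hp => List.prefix_of_prefix_length_le hp (List.prefix_append (a :: X) [d])
          (by simpa using h), fun hp => hp.trans (List.prefix_append (a :: X) [d])⟩
      have h2 : w <:+ a :: (X ++ [d]) ↔ w <:+ X ++ [d] :=
        ⟨fun hp => List.suffix_of_suffix_length_le hp (List.suffix_cons a _)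
          (by simpa using h), fun hp => hp.trans (List.suffix_cons a _)⟩
      simp only [h1, h2]
      omega
    · have h1 : ¬ w <+: a :: X := fun hp => by have := hp.length_le; simp at this; omega
      have h2 : ¬ w <:+ X ++ [d] := fun hp => by have := hp.length_le; simp at this; omega
      have h3 : w <+: a :: (X ++ [d]) ↔ w <:+ a :: (X ++ [d]) := by
        constructor
        · intro hp
          rw [hp.eq_of_length (by have := hp.length_le; simp at *; omega)]
        · intro hp
          rw [hp.eq_of_length (by have := hp.length_le; simp at *; omega)]
      simp only [h1, h2, h3]

lemma occCount_append_self_append (w : List α) (hw : 1 ≤ w.length) (Y Z : List α) :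
    occCount w (Y ++ w ++ Z) + 1 = occCount w (Y ++ w) + occCount w (w ++ Z) := by
  induction Y with
  | nil => simp [occCount_self w hw, add_comm]
  | cons a Y ih =>
    have h : w <+: a :: (Y ++ w ++ Z) ↔ w <+: a :: (Y ++ w) :=
      ⟨fun hp => List.prefix_of_prefix_length_le hp (List.prefix_append (a :: (Y ++ w)) Z)
        (by simp; omega), fun hp => hp.trans (List.prefix_append (a :: (Y ++ w)) Z)⟩
    simp only [List.cons_append, occCount_cons, h]
    omega

end Occurrences

section BlockMean

variable {b : ℕ}

/-- The mean of `f` over all strings of length `N` over `{0,…,b-1}`. -/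
noncomputable def blockMean (b : ℕ) : ℕ → (List (Fin b) → ℝ≥0∞) → ℝ≥0∞
  | 0, f => f []
  | N + 1, f => (b : ℝ≥0∞)⁻¹ * ∑ d : Fin b, blockMean b N fun Z => f (d :: Z)

lemma inv_mul_sum_const (hb : 1 < b) (c : ℝ≥0∞) :
    (b : ℝ≥0∞)⁻¹ * ∑ _d : Fin b, c = c := by
  rw [Finset.sum_const, Finset.card_univ, Fintype.card_fin, nsmul_eq_mul, ← mul_assoc,
    ENNReal.inv_mul_cancel (by simp; omega) (by simp), one_mul]

lemma blockMean_mono (N : ℕ) {f g : List (Fin b) → ℝ≥0∞}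
    (h : ∀ Z, Z.length = N → f Z ≤ g Z) : blockMean b N f ≤ blockMean b N g := by
  induction N generalizing f g with
  | zero => exact h [] rfl
  | succ N ih =>
    unfold blockMean
    gcongr with d
    exact ih fun Z hZ => h _ (by simp [hZ])

lemma blockMean_congr (N : ℕ) {f g : List (Fin b) → ℝ≥0∞}
    (h : ∀ Z, Z.length = N → f Z = g Z) : blockMean b N f = blockMean b N g :=
  le_antisymm (blockMean_mono N fun Z hZ => (h Z hZ).le)
    (blockMean_mono N fun Z hZ => (h Z hZ).ge)

lemma blockMean_const (hb : 1 < b) (N : ℕ) (c : ℝ≥0∞) : blockMean b N (fun _ => c) = c := by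
  induction N with
  | zero => rfl
  | succ N ih => simp only [blockMean, ih, inv_mul_sum_const hb]

lemma blockMean_zero (N : ℕ) : blockMean b N (fun _ => 0) = 0 := by
  induction N with
  | zero => rfl
  | succ N ih => simp [blockMean, ih]

lemma blockMean_add (N : ℕ) (f g : List (Fin b) → ℝ≥0∞) :
    blockMean b N (fun Z => f Z + g Z) = blockMean b N f + blockMean b N g := by
  induction N generalizing f g with
  | zero => rfl
  | succ N ih => simp only [blockMean, ih, Finset.sum_add_distrib, mul_add]

lemma blockMean_mul_left (N : ℕ) (c : ℝ≥0∞) (f : List (Fin b) → ℝ≥0∞) :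
    blockMean b N (fun Z => c * f Z) = c * blockMean b N f := by
  induction N generalizing f with
  | zero => rfl
  | succ N ih => simp only [blockMean, ih, ← Finset.mul_sum, mul_left_comm]

lemma blockMean_mul_right (N : ℕ) (c : ℝ≥0∞) (f : List (Fin b) → ℝ≥0∞) :
    blockMean b N (fun Z => f Z * c) = blockMean b N f * c := by
  simp only [mul_comm _ c, blockMean_mul_left]

lemma blockMean_sum {ι : Type*} (s : Finset ι) (N : ℕ) (f : ι → List (Fin b) → ℝ≥0∞) :
    blockMean b N (fun Z => ∑ i ∈ s, f i Z) = ∑ i ∈ s, blockMean b N (f i) := by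
  classical
  induction s using Finset.induction_on with
  | empty => simp [blockMean_zero]
  | insert i s hi ih => simp only [Finset.sum_insert hi, blockMean_add, ih]

lemma blockMean_add_length (m n : ℕ) (f : List (Fin b) → ℝ≥0∞) :
    blockMean b (m + n) f = blockMean b m fun X => blockMean b n fun Y => f (X ++ Y) := by
  induction m generalizing f with
  | zero => simp [blockMean]
  | succ m ih =>
    rw [show m + 1 + n = m + n + 1 by omega]
    simp only [blockMean, ih, List.cons_append]

lemma blockMean_prefix (w : List (Fin b)) (m : ℕ) (f : List (Fin b) → ℝ≥0∞) :
    blockMean b (w.length + m) (fun Z => if w <+: Z then f Z else 0) =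
      ((b : ℝ≥0∞) ^ w.length)⁻¹ * blockMean b m fun Z => f (w ++ Z) := by
  induction w generalizing f with
  | nil => simp
  | cons a w ih =>
    rw [List.length_cons, show w.length + 1 + m = w.length + m + 1 by omega, blockMean,
      Finset.sum_eq_single a]
    · simp only [List.cons_prefix_cons, true_and, ih (fun Z => f (a :: Z)), List.cons_append]
      rw [← mul_assoc, pow_succ', ENNReal.mul_inv (by simp) (by simp)]
    · intro d _ hd
      simp [List.cons_prefix_cons, hd.symm, blockMean_zero]
    · simp

lemma tsum_length_eq_blockMean (f : List (Fin b) → ℝ≥0∞) (N : ℕ) :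
    ∑' Z : {Z : List (Fin b) // Z.length = N}, ((b : ℝ≥0∞) ^ N)⁻¹ * f Z = blockMean b N f := by
  induction N generalizing f with
  | zero =>
    rw [tsum_eq_single ⟨[], rfl⟩]
    · simp [blockMean]
    · rintro ⟨Z, hZ⟩ h
      exact absurd (Subtype.ext (List.length_eq_zero_iff.1 hZ)) h
  | succ N ih =>
    let e : Fin b × {Z : List (Fin b) // Z.length = N} ≃
        {Z : List (Fin b) // Z.length = N + 1} :=
      { toFun := fun x => ⟨x.1 :: x.2.1, by simp [x.2.2]⟩
        invFun := fun Z => (Z.1.head (by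
          intro h
          have := Z.2
          simp [h] at this), ⟨Z.1.tail, by simp [Z.2]⟩)
        left_inv := fun x => by simp
        right_inv := fun Z => by simp }
    rw [← e.tsum_eq, ENNReal.summable.tsum_prod' fun _ => ENNReal.summable, tsum_fintype,
      blockMean, Finset.mul_sum]
    refine Finset.sum_congr rfl fun d _ => ?_
    rw [← ih, ← ENNReal.tsum_mul_left]
    refine tsum_congr fun Z => ?_
    rw [pow_succ', ENNReal.mul_inv (by simp) (by simp), mul_assoc]
    rfl

lemma tsum_list_eq_tsum_blockMean (f : List (Fin b) → ℝ≥0∞) :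
    ∑' Z : List (Fin b), ((b : ℝ≥0∞) ^ Z.length)⁻¹ * f Z = ∑' N, blockMean b N f := by
  rw [← (Equiv.sigmaFiberEquiv (List.length : List (Fin b) → ℕ)).tsum_eq, ENNReal.tsum_sigma']
  refine tsum_congr fun N => ?_
  rw [← tsum_length_eq_blockMean]
  refine tsum_congr fun Z => ?_
  simp only [Equiv.sigmaFiberEquiv_apply, Z.2]

end BlockMean

section Renewal

variable {b : ℕ}

/-- The proportion of strings `Z` of length `N` such that `X ++ Z` has exactly `k`
occurrences of `w`. -/
noncomputable def occMean (w : List (Fin b)) (k : ℕ) (X : List (Fin b)) (N : ℕ) : ℝ≥0∞ :=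
  blockMean b N fun Z => if occCount w (X ++ Z) = k then 1 else 0

lemma occMean_succ (w : List (Fin b)) (k : ℕ) (X : List (Fin b)) (N : ℕ) :
    occMean w k X (N + 1) = (b : ℝ≥0∞)⁻¹ * ∑ d : Fin b, occMean w k (X ++ [d]) N := by
  simp [occMean, blockMean]

lemma occMean_zero_add (hb : 1 < b) (w : List (Fin b)) (m : ℕ) (p : ℕ)
    (hw : w.length = p + 1) :
    occMean w 0 [] (p + m) =
      occMean w 0 [] (p + (m + 1)) + ((b : ℝ≥0∞) ^ w.length)⁻¹ * occMean w 1 w m := by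
  have h := blockMean_prefix w m fun Z => if occCount w Z = 1 then 1 else 0
  unfold occMean
  rw [← h, hw, show p + (m + 1) = p + m + 1 by omega, show p + 1 + m = p + m + 1 by omega,
    ← blockMean_add, blockMean]
  rw [← inv_mul_sum_const hb (blockMean b (p + m) _)]
  congr 1
  refine Finset.sum_congr rfl fun d _ => blockMean_congr _ fun Z _ => ?_
  simp only [List.nil_append, occCount_cons]
  by_cases hp : w <+: d :: Z <;> simp [hp]

lemma occMean_zero_nil_eq_one (hb : 1 < b) (w : List (Fin b)) (N : ℕ) (h : N < w.length) :
    occMean w 0 [] N = 1 := by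
  rw [← blockMean_const hb N 1]
  refine blockMean_congr _ fun Z hZ => ?_
  simp [occCount_eq_zero_of_length_lt w Z (by omega)]

lemma sum_occMean_add (hb : 1 < b) (w : List (Fin b)) (p : ℕ) (hw : w.length = p + 1) (M : ℕ) :
    ((b : ℝ≥0∞) ^ w.length)⁻¹ * ∑ m ∈ Finset.range M, occMean w 1 w m +
      occMean w 0 [] (p + M) = 1 := by
  induction M with
  | zero => simp [occMean_zero_nil_eq_one hb w p (by omega)]
  | succ M ih =>
    rw [Finset.sum_range_succ, mul_add, ← ih, occMean_zero_add hb w M p hw]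
    ring

lemma occMean_zero_nil_add_le (w : List (Fin b)) (m n : ℕ) :
    occMean w 0 [] (m + n) ≤ occMean w 0 [] m * occMean w 0 [] n := by
  unfold occMean
  rw [blockMean_add_length, ← blockMean_mul_right]
  refine blockMean_mono _ fun X _ => ?_
  rw [← blockMean_mul_left]
  refine blockMean_mono _ fun Y _ => ?_
  have h1 := occCount_le_append_left w X Y
  have h2 := occCount_le_append_right w X Y
  simp only [List.nil_append]
  by_cases h : occCount w (X ++ Y) = 0
  · simp [h, show occCount w X = 0 by omega, show occCount w Y = 0 by omega]
  · simp [h]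

lemma occMean_le_one (hb : 1 < b) (w : List (Fin b)) (k : ℕ) (X : List (Fin b)) (N : ℕ) :
    occMean w k X N ≤ 1 := by
  conv_rhs => rw [← blockMean_const hb N 1]
  refine blockMean_mono _ fun Z _ => ?_
  split_ifs <;> simp

lemma occMean_zero_nil_length_lt_one (hb : 1 < b) (w : List (Fin b)) (hw : 1 ≤ w.length) :
    occMean w 0 [] w.length < 1 := by
  obtain ⟨p, hp⟩ : ∃ p, w.length = p + 1 := ⟨w.length - 1, by omega⟩
  have h := sum_occMean_add hb w p hp 1
  have h0 : occMean w 1 w 0 = 1 := by simp [occMean, blockMean, occCount_self w hw]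
  rw [Finset.sum_range_one, h0, mul_one, ← hp] at h
  rw [← h, add_comm]
  refine ENNReal.lt_add_right ?_ ?_
  · exact ((occMean_le_one hb w 0 [] _).trans_lt ENNReal.one_lt_top).ne
  · simp [ENNReal.pow_eq_top_iff]

lemma tendsto_occMean_zero_nil (hb : 1 < b) (w : List (Fin b)) (hw : 1 ≤ w.length) :
    Tendsto (occMean w 0 []) atTop (𝓝 0) := by
  have hanti : Antitone (occMean w 0 ([] : List (Fin b))) := by
    refine antitone_nat_of_succ_le fun n => ?_
    refine (occMean_zero_nil_add_le w n 1).trans ?_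
    exact mul_le_of_le_one_right' (occMean_le_one hb w 0 [] 1)
  have hlim := tendsto_atTop_iInf hanti
  set L := ⨅ n, occMean w 0 ([] : List (Fin b)) n with hL
  have hlt := occMean_zero_nil_length_lt_one hb w hw
  have hle : L ≤ L * occMean w 0 [] w.length := by
    have h1 : Tendsto (fun n => occMean w 0 [] n * occMean w 0 [] w.length) atTop
        (𝓝 (L * occMean w 0 [] w.length)) :=
      ENNReal.Tendsto.mul_const hlim (Or.inr (hlt.trans ENNReal.one_lt_top).ne)
    exact ge_of_tendsto' h1 fun n => (iInf_le _ _).trans (occMean_zero_nil_add_le w n w.length)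
  have hL0 : L = 0 := by
    by_contra h0
    have htop : L ≠ ∞ :=
      (((iInf_le _ 0).trans (occMean_le_one hb w 0 [] 0)).trans_lt ENNReal.one_lt_top).ne
    have := ENNReal.mul_lt_mul_right h0 htop hlt
    rw [mul_one] at this
    exact absurd hle (not_le.2 this)
  rwa [hL0] at hlim

lemma tsum_occMean_self (hb : 1 < b) (w : List (Fin b)) (hw : 1 ≤ w.length) :
    ∑' m, occMean w 1 w m = (b : ℝ≥0∞) ^ w.length := by
  obtain ⟨p, hp⟩ : ∃ p, w.length = p + 1 := ⟨w.length - 1, by omega⟩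
  have hb0 : (b : ℝ≥0∞) ^ w.length ≠ 0 := pow_ne_zero _ (by simp; omega)
  have hbt : (b : ℝ≥0∞) ^ w.length ≠ ∞ := ENNReal.pow_ne_top (by simp)
  have h1 : Tendsto (fun M => ((b : ℝ≥0∞) ^ w.length)⁻¹ *
      ∑ m ∈ Finset.range M, occMean w 1 w m + occMean w 0 [] (p + M)) atTop
      (𝓝 (((b : ℝ≥0∞) ^ w.length)⁻¹ * ∑' m, occMean w 1 w m + 0)) := by
    refine Tendsto.add (ENNReal.Tendsto.const_mul ENNReal.summable.hasSum.tendsto_sum_nat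
      (Or.inr (ENNReal.inv_ne_top.2 hb0))) ?_
    exact (tendsto_occMean_zero_nil hb w hw).comp
      (tendsto_atTop_mono (fun n => Nat.le_add_left n p) tendsto_id)
  simp only [sum_occMean_add hb w p hp, add_zero] at h1
  have h2 := tendsto_nhds_unique h1 tendsto_const_nhds
  calc ∑' m, occMean w 1 w m
      = (b : ℝ≥0∞) ^ w.length * (((b : ℝ≥0∞) ^ w.length)⁻¹ * ∑' m, occMean w 1 w m) := by
        rw [← mul_assoc, ENNReal.mul_inv_cancel hb0 hbt, one_mul]
    _ = _ := by rw [h2, mul_one]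

lemma tsum_occMean_of_suffix (hb : 1 < b) (w : List (Fin b)) (hw : 1 ≤ w.length)
    (X : List (Fin b)) (hX : w <:+ X) :
    ∑' m, occMean w (occCount w X) X m = (b : ℝ≥0∞) ^ w.length := by
  rw [← tsum_occMean_self hb w hw]
  obtain ⟨Y, rfl⟩ := hX
  refine tsum_congr fun m => blockMean_congr _ fun Z _ => ?_
  have h := occCount_append_self_append w hw Y Z
  congr 1
  exact propext ⟨fun _ => by omega, fun _ => by omega⟩

lemma occMean_zero_of_lt (w : List (Fin b)) (k : ℕ) (X : List (Fin b)) (h : occCount w X < k) :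
    occMean w k X 0 = 0 := by
  simp [occMean, blockMean, h.ne]

lemma occCount_concat_cases (w : List (Fin b)) (hw : 1 ≤ w.length) (k : ℕ) (X : List (Fin b))
    (d : Fin b) (h : occCount w X < k) :
    occCount w (X ++ [d]) < k ∨ (w <:+ X ++ [d] ∧ k = occCount w (X ++ [d])) := by
  have hc := occCount_concat w hw X d
  by_cases hs : w <:+ X ++ [d]
  · rw [if_pos hs] at hc
    rcases (show occCount w X + 1 ≤ k from h).lt_or_eq with h1 | h1
    · exact Or.inl (by omega)
    · exact Or.inr ⟨hs, by omega⟩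
  · rw [if_neg hs] at hc
    exact Or.inl (by omega)

lemma sum_occMean_le (hb : 1 < b) (w : List (Fin b)) (hw : 1 ≤ w.length) (k : ℕ) (N : ℕ)
    (X : List (Fin b)) (hX : occCount w X < k) :
    ∑ n ∈ Finset.range N, occMean w k X n ≤ (b : ℝ≥0∞) ^ w.length := by
  induction N generalizing X with
  | zero => simp
  | succ N ih =>
    rw [Finset.sum_range_succ', occMean_zero_of_lt w k X hX, add_zero]
    simp only [occMean_succ]
    rw [← Finset.mul_sum, Finset.sum_comm, ← inv_mul_sum_const hb ((b : ℝ≥0∞) ^ w.length)]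
    gcongr with d
    rcases occCount_concat_cases w hw k X d hX with h | ⟨hs, h⟩
    · exact ih _ h
    · rw [h, ← tsum_occMean_of_suffix hb w hw _ hs]
      exact ENNReal.sum_le_tsum _

lemma tsum_occMean_le (hb : 1 < b) (w : List (Fin b)) (hw : 1 ≤ w.length) (k : ℕ)
    (X : List (Fin b)) (hX : occCount w X < k) :
    ∑' n, occMean w k X n ≤ (b : ℝ≥0∞) ^ w.length :=
  le_of_tendsto' ENNReal.summable.hasSum.tendsto_sum_nat
    fun N => sum_occMean_le hb w hw k N X hX

lemma tsum_occMean_succ (w : List (Fin b)) (k : ℕ) (X : List (Fin b)) (hX : occCount w X < k) :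
    ∑' n, occMean w k X n = (b : ℝ≥0∞)⁻¹ * ∑ d : Fin b, ∑' n, occMean w k (X ++ [d]) n := by
  rw [tsum_eq_zero_add' ENNReal.summable, occMean_zero_of_lt w k X hX, zero_add]
  simp only [occMean_succ]
  rw [ENNReal.tsum_mul_left, Summable.tsum_finsetSum fun _ _ => ENNReal.summable]

lemma le_tsum_occMean_add (hb : 1 < b) (w : List (Fin b)) (hw : 1 ≤ w.length) (k : ℕ) (N : ℕ)
    (X : List (Fin b)) (hX : occCount w X < k) :
    (b : ℝ≥0∞) ^ w.length ≤ ∑' n, occMean w k X n + (b : ℝ≥0∞) ^ w.length *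
      blockMean b N fun Z => if occCount w (X ++ Z) < k then 1 else 0 := by
  induction N generalizing X with
  | zero => simp [blockMean, hX]
  | succ N ih =>
    rw [tsum_occMean_succ w k X hX, blockMean, mul_left_comm, ← mul_add, Finset.mul_sum,
      ← Finset.sum_add_distrib]
    conv_lhs => rw [← inv_mul_sum_const hb ((b : ℝ≥0∞) ^ w.length)]
    gcongr with d
    rcases occCount_concat_cases w hw k X d hX with h | ⟨hs, h⟩
    · simpa using ih _ h
    · rw [h, tsum_occMean_of_suffix hb w hw _ hs]
      exact le_self_add

lemma tendsto_blockMean_occCount_lt (hb : 1 < b) (w : List (Fin b)) (hw : 1 ≤ w.length) (k : ℕ)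
    (X : List (Fin b)) :
    Tendsto (fun N => blockMean b N fun Z => if occCount w (X ++ Z) < k then 1 else 0)
      atTop (𝓝 0) := by
  have hj : ∀ j, Tendsto (occMean w j ([] : List (Fin b))) atTop (𝓝 0) := by
    intro j
    rcases Nat.eq_zero_or_pos j with rfl | hj
    · exact tendsto_occMean_zero_nil hb w hw
    · refine ENNReal.tendsto_atTop_zero_of_tsum_ne_top (ne_top_of_le_ne_top ?_
        (tsum_occMean_le hb w hw j [] (by simpa [occCount_nil] using hj)))
      exact ENNReal.pow_ne_top (by simp)
  have hsum : Tendsto (fun N => ∑ j ∈ Finset.range k, occMean w j ([] : List (Fin b)) N)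
      atTop (𝓝 0) := by
    simpa using tendsto_finsetSum (Finset.range k) fun j _ => hj j
  refine tendsto_of_tendsto_of_tendsto_of_le_of_le tendsto_const_nhds hsum
    (fun _ => zero_le) fun N => ?_
  simp only [occMean]
  rw [← blockMean_sum]
  refine blockMean_mono _ fun Z _ => ?_
  have h := occCount_le_append_left w X Z
  by_cases hlt : occCount w (X ++ Z) < k
  · simp [hlt, show occCount w Z < k by omega]
  · simp [hlt]

lemma tsum_occMean (hb : 1 < b) (w : List (Fin b)) (hw : 1 ≤ w.length) (k : ℕ)
    (X : List (Fin b)) (hX : occCount w X < k) :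
    ∑' n, occMean w k X n = (b : ℝ≥0∞) ^ w.length := by
  refine le_antisymm (tsum_occMean_le hb w hw k X hX) ?_
  have h : Tendsto (fun N => ∑' n, occMean w k X n + (b : ℝ≥0∞) ^ w.length *
      blockMean b N fun Z => if occCount w (X ++ Z) < k then 1 else 0) atTop
      (𝓝 (∑' n, occMean w k X n + (b : ℝ≥0∞) ^ w.length * 0)) :=
    tendsto_const_nhds.add (ENNReal.Tendsto.const_mul
      (tendsto_blockMean_occCount_lt hb w hw k X) (Or.inr (ENNReal.pow_ne_top (by simp))))
  rw [mul_zero, add_zero] at h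
  exact ge_of_tendsto' h fun N => le_tsum_occMean_add hb w hw k N X hX

end Renewal

section Digits

variable {b : ℕ}

lemma listVal_concat (X : List (Fin b)) (d : Fin b) :
    listVal b (X ++ [d]) = b * listVal b X + d := by
  simp [listVal]

lemma listVal_append (X Z : List (Fin b)) :
    listVal b (X ++ Z) = listVal b X * b ^ Z.length + listVal b Z := by
  induction Z using List.reverseRecOn with
  | nil => simp [listVal]
  | append_singleton Z d ih =>
    rw [← List.append_assoc, listVal_concat, listVal_concat, ih]
    simp only [List.length_append, List.length_singleton, pow_succ]
    ring

lemma listVal_lt (X : List (Fin b)) : listVal b X < b ^ X.length := by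
  induction X using List.reverseRecOn with
  | nil => simp [listVal]
  | append_singleton X d ih =>
    rw [listVal_concat, List.length_append, List.length_singleton, pow_succ]
    have := d.2
    nlinarith

lemma listVal_injOn (X Y : List (Fin b)) (hlen : X.length = Y.length)
    (h : listVal b X = listVal b Y) : X = Y := by
  induction X using List.reverseRecOn generalizing Y with
  | nil => exact (List.length_eq_zero_iff.1 hlen.symm).symm
  | append_singleton X d ih =>
    rcases List.eq_nil_or_concat' Y with rfl | ⟨Y, e, rfl⟩
    · simp at hlen
    · rw [listVal_concat, listVal_concat] at h
      have h1 := congrArg (· % b) h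
      have h2 := congrArg (· / b) h
      have hbpos : 0 < b := d.pos
      simp only [Nat.mul_add_mod, Nat.mod_eq_of_lt d.2, Nat.mod_eq_of_lt e.2] at h1
      simp only [Nat.mul_add_div hbpos, Nat.div_eq_of_lt d.2, Nat.div_eq_of_lt e.2,
        add_zero] at h2
      rw [ih Y (by simpa using hlen) h2, Fin.ext h1]

lemma exists_listVal_eq (l n : ℕ) (hn : n < b ^ l) :
    ∃ Y : List (Fin b), Y.length = l ∧ listVal b Y = n := by
  induction l generalizing n with
  | zero => exact ⟨[], rfl, by simp at hn; simp [listVal, hn]⟩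
  | succ l ih =>
    have hbpos : 0 < b := by
      rcases Nat.eq_zero_or_pos b with rfl | h
      · simp at hn
      · exact h
    obtain ⟨Y, hY, hv⟩ := ih (n / b) (by
      rw [Nat.div_lt_iff_lt_mul hbpos]
      simpa [pow_succ] using hn)
    refine ⟨Y ++ [⟨n % b, Nat.mod_lt _ hbpos⟩], by simp [hY], ?_⟩
    rw [listVal_concat, hv]
    exact Nat.div_add_mod n b

lemma listVal_append_div_mem_Ico_iff (hb : 1 < b) (X Z : List (Fin b)) (n : ℕ) :
    (listVal b (X ++ Z) : ℝ) / (b : ℝ) ^ (X ++ Z).length ∈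
      Set.Ico ((n : ℝ) / (b : ℝ) ^ X.length) (((n : ℝ) + 1) / (b : ℝ) ^ X.length) ↔
      listVal b X = n := by
  have hb0 : (0 : ℝ) < b := by exact_mod_cast (by omega : 0 < b)
  have hX : (0 : ℝ) < (b : ℝ) ^ X.length := pow_pos hb0 _
  have hZ : (0 : ℝ) < (b : ℝ) ^ Z.length := pow_pos hb0 _
  have hlt := listVal_lt Z
  have hZ' : 0 < b ^ Z.length := pow_pos (by omega) _
  rw [List.length_append, pow_add, mul_comm, ← div_div, Set.mem_Ico, div_le_div_iff_of_pos_right hX,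
    div_lt_div_iff_of_pos_right hX, le_div_iff₀ hZ, div_lt_iff₀ hZ, listVal_append]
  norm_cast
  constructor
  · rintro ⟨h1, h2⟩
    have h3 : n < listVal b X + 1 := by
      by_contra! h
      nlinarith [Nat.mul_le_mul_right (b ^ Z.length) h]
    have h4 : listVal b X < n + 1 := by
      by_contra! h
      nlinarith [Nat.mul_le_mul_right (b ^ Z.length) h]
    omega
  · rintro rfl
    constructor
    · omega
    · linarith [add_mul (listVal b X) 1 (b ^ Z.length)]

end Digits

/-- For `0 ≤ n < b^l` and `k ≥ l+1`, `μ_k([n/b^l, (n+1)/b^l)) = b^p · b^{-l}`. -/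
theorem stmt17 (b : ℕ) (hb : 1 < b) (w : List (Fin b)) (hw : 1 ≤ w.length)
    (l n k : ℕ) (hn : n < b ^ l) (hk : l + 1 ≤ k) :
    mu b w k (Set.Ico ((n : ℝ) / (b : ℝ) ^ l) (((n : ℝ) + 1) / (b : ℝ) ^ l)) =
      (b : ℝ≥0∞) ^ w.length * ((b : ℝ≥0∞) ^ l)⁻¹ := by
  obtain ⟨Y, rfl, rfl⟩ := exists_listVal_eq l n hn
  have hocc : occCount w Y < k := (occCount_le_length w Y).trans_lt hk
  set I := Set.Ico ((listVal b Y : ℝ) / (b : ℝ) ^ Y.length)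
    (((listVal b Y : ℝ) + 1) / (b : ℝ) ^ Y.length)
  have hmeas : MeasurableSet I := measurableSet_Ico
  set S : Set (List (Fin b)) := {X | occCount w X = k}
  let F : List (Fin b) → ℝ≥0∞ := fun X =>
    ((b : ℝ≥0∞) ^ X.length)⁻¹ *
      I.indicator 1 ((listVal b X : ℝ) / (b : ℝ) ^ X.length)
  have hmu : mu b w k I = ∑' X, S.indicator F X := by
    rw [mu, Measure.sum_apply _ hmeas, ← tsum_subtype]
    refine tsum_congr fun X => ?_
    simp [F, Measure.dirac_apply' _ hmeas]
  have hsupp : Function.support (S.indicator F) ⊆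
      Set.range (Y ++ ·) := by
    intro X hX
    have hXk : X ∈ S := Set.mem_of_indicator_ne_zero hX
    have hlen : Y.length ≤ X.length := by
      have := occCount_le_length w X
      have : occCount w X = k := hXk
      omega
    have hF : F X ≠ 0 := by
      rw [Function.mem_support, Set.indicator_of_mem hXk] at hX
      exact hX
    have hmem : (listVal b X : ℝ) / (b : ℝ) ^ X.length ∈ I :=
      Set.mem_of_indicator_ne_zero (right_ne_zero_of_mul hF)
    have htake : (X.take Y.length).length = Y.length := by simp [hlen]
    have h := listVal_append_div_mem_Ico_iff hb (X.take Y.length) (X.drop Y.length)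
      (listVal b Y)
    rw [List.take_append_drop, htake] at h
    have hYX := listVal_injOn _ _ htake (h.1 hmem)
    refine ⟨X.drop Y.length, ?_⟩
    calc Y ++ X.drop Y.length = X.take Y.length ++ X.drop Y.length := by rw [hYX]
      _ = X := List.take_append_drop _ _
  rw [hmu, ← (List.append_right_injective Y).tsum_eq hsupp, ← tsum_occMean hb w hw k Y hocc,
    mul_comm]
  simp only [occMean]
  rw [← tsum_list_eq_tsum_blockMean, ← ENNReal.tsum_mul_left]
  refine tsum_congr fun Z => ?_
  have hmem : (listVal b (Y ++ Z) : ℝ) / (b : ℝ) ^ (Y ++ Z).length ∈ I :=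
    (listVal_append_div_mem_Ico_iff hb Y Z _).2 rfl
  by_cases h : occCount w (Y ++ Z) = k
  · rw [Set.indicator_of_mem (show Y ++ Z ∈ S from h)]
    simp only [F, Set.indicator_of_mem hmem, if_pos h, Pi.one_apply, mul_one]
    rw [List.length_append, pow_add,
      ENNReal.mul_inv (Or.inr (ENNReal.pow_ne_top (by simp)))
        (Or.inl (ENNReal.pow_ne_top (by simp)))]
  · rw [Set.indicator_of_notMem (show Y ++ Z ∉ S from h), if_neg h]
    simp
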